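/- For every Laurent polynomial p ∈ ℂ[x,x⁻¹]: −B(dp/dx) + k u^{k−1}·∂(B p)/∂x = ∂(B p)/∂u in L((u⁻¹)). (This is equation (2.8) of the paper, −Δ_k^x(z)^{−1}(∂/∂x) + k z^{−1/k+1} (∂/∂x) Δ_k^x(z)^{−1} = k z^{−1/k+1} (∂/∂z) Δ_k^x(z)^{−1}, rewritten in the variable u = z^{1/k}.) -/

import Mathlib

/-!
STATEMENT 6.  Equation (2.8) of the paper, rewritten in the variable `u = z^{1/k}`:
for every Laurent polynomial `p ∈ ℂ[x,x⁻¹]`,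
`−B(dp/dx) + k u^{k−1}·∂(B p)/∂x = ∂(B p)/∂u`  in `L((u⁻¹))`,
where `L = ℂ[x,x⁻¹]` and `L((u⁻¹))` is the ring of formal Laurent series in `u⁻¹` over `L`
(finitely many positive powers of `u`).

We model `L((u⁻¹))` as `HahnSeries ℤ L`, the index `m ∈ ℤ` recording the coefficient of
`u^{−m}` (so multiplication matches, `u^{k−1}` is `single (1−k) 1`, and a series has
finitely many positive powers of `u` precisely when its support is bounded below).

`b = Σ_{l≥1} C(1/k,l) u^{1−kl} x^l` (so the coefficient of `u^{−m}` is `C(1/k,l)·x^l`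
when `m = kl−1`, `l ≥ 1`, and `0` otherwise), and `B : L → L((u⁻¹))` is the (unique)
`ℂ`-algebra homomorphism with `B(x) = b`, taken as a hypothesis; `x = LaurentPolynomial.T 1`.
`∂/∂x` acts coefficientwise through the derivative `Dx` of `L` (the unique `ℂ`-linear map
with `Dx(xⁿ) = n xⁿ⁻¹`), and `∂/∂u` is the formal derivative in `u`:
`d/du (u^{−(q−1)}) = (1−q) u^{−q}`.
-/

open LaurentPolynomial

/-- Subsets of `ℤ` bounded below are partially well ordered. -/
lemma Int.isPWO_of_subset_Ici {a : ℤ} {s : Set ℤ} (h : s ⊆ Set.Ici a) : s.IsPWO :=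
  Set.IsWF.isPWO (BddBelow.wellFoundedOn_lt ⟨a, fun _ hx => h hx⟩)

/-- The generalized binomial coefficient `C(a,m) = a(a−1)⋯(a−m+1)/m!`. -/
noncomputable def genBinom (a : ℂ) (m : ℕ) : ℂ :=
  (∏ i ∈ Finset.range m, (a - i)) / m.factorial

/-- `b = Σ_{l≥1} C(1/k,l) u^{1−kl} x^l ∈ L((u⁻¹))` (indexing: `coeff m` is the coefficient
of `u^{−m}`). -/
noncomputable def bSeries (k : ℕ) : HahnSeries ℤ (LaurentPolynomial ℂ) where
  coeff m :=
    if 0 ≤ m ∧ (m + 1) % (k : ℤ) = 0 then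
      genBinom ((k : ℂ)⁻¹) ((m + 1) / (k : ℤ)).toNat • LaurentPolynomial.T ((m + 1) / (k : ℤ))
    else 0
  isPWO_support' := Int.isPWO_of_subset_Ici (a := 0) (by
    intro m hm
    simp only [Function.mem_support] at hm
    by_contra hlt
    simp only [Set.mem_Ici, not_le] at hlt
    exact hm (by rw [if_neg (by intro hc; exact absurd hc.1 (by omega))]))

/-- `∂/∂x` on `L((u⁻¹))`: apply the derivative `Dx` of `L = ℂ[x,x⁻¹]` to each coefficient. -/
noncomputable def derivX (Dx : LaurentPolynomial ℂ →ₗ[ℂ] LaurentPolynomial ℂ)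
    (F : HahnSeries ℤ (LaurentPolynomial ℂ)) : HahnSeries ℤ (LaurentPolynomial ℂ) where
  coeff m := Dx (F.coeff m)
  isPWO_support' := F.isPWO_support'.mono (by
    intro m hm
    simp only [Function.mem_support] at hm ⊢
    intro h0
    exact hm (by rw [h0, map_zero]))

/-- `∂/∂u` on `L((u⁻¹))` (indexing: `coeff q` is the coefficient of `u^{−q}`):
the formal derivative in `u`, `coeff q (∂F/∂u) = (1−q) • coeff (q−1) F`. -/
noncomputable def derivU (F : HahnSeries ℤ (LaurentPolynomial ℂ)) :
    HahnSeries ℤ (LaurentPolynomial ℂ) where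
  coeff q := (1 - q) • F.coeff (q - 1)
  isPWO_support' := by
    refine (F.isPWO_support'.image_of_monotone
      (f := fun m : ℤ => m + 1) (fun x y h => by dsimp only; omega)).mono ?_
    intro q hq
    simp only [Function.mem_support] at hq
    refine ⟨q - 1, ?_, by dsimp only; omega⟩
    simp only [Function.mem_support]
    intro h0
    exact hq (by rw [h0, smul_zero])

/-- An additive operator on Hahn series acting coefficientwise by maps `d m` that satisfy a graded
Leibniz rule is itself a derivation. -/
lemma HahnSeries.leibniz_of_coeff {Γ R : Type*} [AddCommMonoid Γ] [PartialOrder Γ]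
    [IsOrderedCancelAddMonoid Γ] [NonUnitalNonAssocSemiring R]
    (d : Γ → R →+ R) (hd : ∀ i j a b, d (i + j) (a * b) = d i a * b + a * d j b)
    (T : HahnSeries Γ R → HahnSeries Γ R) (hT : ∀ F m, (T F).coeff m = d m (F.coeff m))
    (F G : HahnSeries Γ R) : T (F * G) = T F * G + F * T G := by
  have hsupp : ∀ F, (T F).support ⊆ F.support := fun F m hm h0 => hm <| by
    rw [hT, h0, map_zero]
  ext m
  rw [hT, HahnSeries.coeff_add, HahnSeries.coeff_mul_left' F.isPWO_support (hsupp F),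
    HahnSeries.coeff_mul_right' G.isPWO_support (hsupp G), HahnSeries.coeff_mul, map_sum,
    ← Finset.sum_add_distrib]
  refine Finset.sum_congr rfl fun ij hij => ?_
  rw [← (Finset.mem_antidiagonal.mp hij).2.2, hd, hT, hT]

lemma leibniz_of_map_T (Dx : LaurentPolynomial ℂ →ₗ[ℂ] LaurentPolynomial ℂ)
    (hDx : ∀ n : ℤ, Dx (LaurentPolynomial.T n) = n • LaurentPolynomial.T (n - 1))
    (p q : LaurentPolynomial ℂ) : Dx (p * q) = Dx p * q + p * Dx q := by
  induction p using LaurentPolynomial.induction_on' with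
  | add p₁ p₂ h₁ h₂ => simp only [add_mul, map_add, h₁, h₂]; ring
  | C_mul_T m a =>
    induction q using LaurentPolynomial.induction_on' with
    | add q₁ q₂ h₁ h₂ => simp only [mul_add, map_add, h₁, h₂]; ring
    | C_mul_T n b =>
      simp only [← LaurentPolynomial.smul_eq_C_mul, smul_mul_assoc, mul_smul_comm, map_smul,
        ← LaurentPolynomial.T_add, hDx, smul_comm _ a]
      rw [show m - 1 + n = m + n - 1 by ring, show m + (n - 1) = m + n - 1 by ring, add_smul,
        smul_add, smul_add]

lemma derivX_mul (Dx : LaurentPolynomial ℂ →ₗ[ℂ] LaurentPolynomial ℂ)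
    (hDx : ∀ n : ℤ, Dx (LaurentPolynomial.T n) = n • LaurentPolynomial.T (n - 1))
    (F G : HahnSeries ℤ (LaurentPolynomial ℂ)) :
    derivX Dx (F * G) = derivX Dx F * G + F * derivX Dx G :=
  HahnSeries.leibniz_of_coeff (fun _ => Dx.toAddMonoidHom)
    (fun _ _ => leibniz_of_map_T Dx hDx) (derivX Dx) (fun _ _ => rfl) F G

lemma derivU_mul (F G : HahnSeries ℤ (LaurentPolynomial ℂ)) :
    derivU (F * G) = derivU F * G + F * derivU G := by
  let u : HahnSeries ℤ (LaurentPolynomial ℂ) := HahnSeries.single (-1) 1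
  let v : HahnSeries ℤ (LaurentPolynomial ℂ) := HahnSeries.single 1 1
  have hvu : v * u = 1 := by simp [u, v, HahnSeries.single_mul_single]
  have hT := HahnSeries.leibniz_of_coeff (fun m : ℤ => DistribSMul.toAddMonoidHom _ (-m))
    (fun i j a b => by simp; ring) (fun F => u * derivU F)
    (fun F m => by
      have h := HahnSeries.coeff_single_mul_add (r := (1 : LaurentPolynomial ℂ))
        (x := derivU F) (a := m + 1) (b := -1)
      rw [add_neg_cancel_right, one_mul] at h
      rw [h]
      simp [derivU]) F G
  linear_combination v * hT - (derivU (F * G) - derivU F * G - F * derivU G) * hvu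

lemma genBinom_succ (a : ℂ) (l : ℕ) :
    (l + 1) * genBinom a (l + 1) = (a - l) * genBinom a l := by
  have h : (l.factorial : ℂ) ≠ 0 := by exact_mod_cast l.factorial_ne_zero
  have h' : (l + 1 : ℂ) ≠ 0 := by exact_mod_cast l.succ_ne_zero
  rw [genBinom, genBinom, Finset.prod_range_succ, Nat.factorial_succ]
  push_cast
  field_simp

/-- The derivation `∂/∂u − k u^{k−1} ∂/∂x` of `L((u⁻¹))`. -/
noncomputable def transportDeriv (k : ℕ) (Dx : LaurentPolynomial ℂ →ₗ[ℂ] LaurentPolynomial ℂ)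
    (F : HahnSeries ℤ (LaurentPolynomial ℂ)) : HahnSeries ℤ (LaurentPolynomial ℂ) :=
  derivU F - (k : HahnSeries ℤ (LaurentPolynomial ℂ))
    * (HahnSeries.single (1 - (k : ℤ)) (1 : LaurentPolynomial ℂ) * derivX Dx F)

lemma coeff_transportDeriv (k : ℕ) (Dx : LaurentPolynomial ℂ →ₗ[ℂ] LaurentPolynomial ℂ)
    (F : HahnSeries ℤ (LaurentPolynomial ℂ)) (q : ℤ) :
    (transportDeriv k Dx F).coeff q
      = (1 - q) • F.coeff (q - 1) - k • Dx (F.coeff (q + k - 1)) := by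
  have h := HahnSeries.coeff_single_mul_add (r := (1 : LaurentPolynomial ℂ))
    (x := derivX Dx F) (a := q + k - 1) (b := 1 - (k : ℤ))
  rw [show q + k - 1 + (1 - (k : ℤ)) = q by ring, one_mul] at h
  rw [transportDeriv, ← nsmul_eq_mul, HahnSeries.coeff_sub, HahnSeries.coeff_nsmul, Pi.smul_apply,
    h]
  rfl

lemma transportDeriv_add (k : ℕ) (Dx : LaurentPolynomial ℂ →ₗ[ℂ] LaurentPolynomial ℂ)
    (F G : HahnSeries ℤ (LaurentPolynomial ℂ)) :
    transportDeriv k Dx (F + G) = transportDeriv k Dx F + transportDeriv k Dx G := by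
  ext1
  funext q
  simp only [coeff_transportDeriv, HahnSeries.coeff_add, map_add, smul_add]
  abel

lemma algebraMap_hahnSeries_laurentPolynomial (c : ℂ) :
    algebraMap ℂ (HahnSeries ℤ (LaurentPolynomial ℂ)) c
      = HahnSeries.C (LaurentPolynomial.C c) := by
  rw [HahnSeries.algebraMap_apply', ← HahnSeries.ofPowerSeries_C, PowerSeries.algebraMap_apply]
  rfl

lemma transportDeriv_algebraMap_mul (k : ℕ)
    (Dx : LaurentPolynomial ℂ →ₗ[ℂ] LaurentPolynomial ℂ)
    (c : ℂ) (F : HahnSeries ℤ (LaurentPolynomial ℂ)) :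
    transportDeriv k Dx (algebraMap ℂ _ c * F) = algebraMap ℂ _ c * transportDeriv k Dx F := by
  ext1
  funext q
  simp only [algebraMap_hahnSeries_laurentPolynomial, HahnSeries.C_mul_eq_smul,
    coeff_transportDeriv, HahnSeries.coeff_smul, smul_eq_mul, ← LaurentPolynomial.smul_eq_C_mul,
    map_smul, smul_sub]
  rw [smul_comm c, smul_comm c k]

lemma transportDeriv_mul (k : ℕ) (Dx : LaurentPolynomial ℂ →ₗ[ℂ] LaurentPolynomial ℂ)
    (hDx : ∀ n : ℤ, Dx (LaurentPolynomial.T n) = n • LaurentPolynomial.T (n - 1))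
    (F G : HahnSeries ℤ (LaurentPolynomial ℂ)) :
    transportDeriv k Dx (F * G) = transportDeriv k Dx F * G + F * transportDeriv k Dx G := by
  simp only [transportDeriv, derivU_mul, derivX_mul Dx hDx]
  ring

lemma bSeries_coeff (k : ℕ) (hk : 0 < k) (l : ℕ) :
    (bSeries k).coeff (k * (l + 1) - 1)
      = genBinom ((k : ℂ)⁻¹) (l + 1) • LaurentPolynomial.T ((l : ℤ) + 1) := by
  have hk' : (k : ℤ) ≠ 0 := by omega
  have h0 : (0 : ℤ) ≤ k * (l + 1) - 1 := by
    have : (0 : ℤ) < k * (l + 1) := by positivity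
    omega
  simp only [bSeries, sub_add_cancel, Int.mul_emod_right, and_true, if_pos h0,
    Int.mul_ediv_cancel_left _ hk']
  rfl

lemma bSeries_coeff_of_neg (k : ℕ) {m : ℤ} (hm : m < 0) : (bSeries k).coeff m = 0 :=
  if_neg fun h => by omega

lemma bSeries_coeff_of_not_dvd (k : ℕ) {m : ℤ} (hm : ¬ (k : ℤ) ∣ m + 1) :
    (bSeries k).coeff m = 0 :=
  if_neg fun h => hm (Int.dvd_of_emod_eq_zero h.2)

lemma transportDeriv_bSeries (k : ℕ) (hk : 0 < k)
    (Dx : LaurentPolynomial ℂ →ₗ[ℂ] LaurentPolynomial ℂ)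
    (hDx : ∀ n : ℤ, Dx (LaurentPolynomial.T n) = n • LaurentPolynomial.T (n - 1)) :
    transportDeriv k Dx (bSeries k) = -1 := by
  have hkC : (k : ℂ) ≠ 0 := by exact_mod_cast hk.ne'
  ext1
  funext q
  rw [coeff_transportDeriv, HahnSeries.coeff_neg, HahnSeries.coeff_one]
  by_cases hq : (k : ℤ) ∣ q
  · obtain ⟨l, rfl⟩ := hq
    rcases lt_or_ge l 0 with hl | hl
    · have h1 : (k : ℤ) * (l + 1) ≤ 0 :=
        mul_nonpos_of_nonneg_of_nonpos (by positivity) (by omega)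
      have h2 : (k : ℤ) * l < 0 := mul_neg_of_pos_of_neg (by omega) hl
      rw [bSeries_coeff_of_neg k (by omega), bSeries_coeff_of_neg k (by linarith), if_neg h2.ne]
      simp
    · lift l to ℕ using hl
      have hX : (k : ℕ) • Dx ((bSeries k).coeff (k * l + k - 1))
          = ((k : ℂ) * (((k : ℂ)⁻¹ - l) * genBinom ((k : ℂ)⁻¹) l)) •
            LaurentPolynomial.T (l : ℤ) := by
        rw [show (k : ℤ) * l + k - 1 = k * (l + 1) - 1 by ring, bSeries_coeff k hk, map_smul, hDx,
          add_sub_cancel_right, ← genBinom_succ, ← Nat.cast_smul_eq_nsmul ℂ,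
          ← Int.cast_smul_eq_zsmul ℂ, smul_smul, smul_smul]
        push_cast
        ring_nf
      rw [hX]
      rcases l with - | l
      · rw [bSeries_coeff_of_neg k (by simp)]
        simp [genBinom, hkC]
      · have h : (k : ℤ) * ((l + 1 : ℕ) : ℤ) ≠ 0 := by positivity
        rw [if_neg h]
        push_cast
        rw [bSeries_coeff k hk, ← Int.cast_smul_eq_zsmul ℂ, smul_smul, ← sub_smul]
        push_cast
        rw [neg_zero, ← zero_smul ℂ (LaurentPolynomial.T ((l : ℤ) + 1) : LaurentPolynomial ℂ)]
        congr 1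
        field_simp
        ring
  · rw [bSeries_coeff_of_not_dvd k (by simpa using hq),
      bSeries_coeff_of_not_dvd k (by simpa [sub_add_cancel] using hq),
      if_neg (by rintro rfl; simp at hq)]
    simp

lemma transportDeriv_map_T (k : ℕ) (hk : 0 < k)
    (Dx : LaurentPolynomial ℂ →ₗ[ℂ] LaurentPolynomial ℂ)
    (hDx : ∀ n : ℤ, Dx (LaurentPolynomial.T n) = n • LaurentPolynomial.T (n - 1))
    (B : LaurentPolynomial ℂ →ₐ[ℂ] HahnSeries ℤ (LaurentPolynomial ℂ))
    (hB : B (LaurentPolynomial.T 1) = bSeries k) (n : ℤ) :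
    transportDeriv k Dx (B (LaurentPolynomial.T n)) = -B (Dx (LaurentPolynomial.T n)) := by
  have hone : transportDeriv k Dx (B (LaurentPolynomial.T 1)) = -1 := by
    rw [hB, transportDeriv_bSeries k hk Dx hDx]
  have hstep (m : ℤ) : transportDeriv k Dx (B (LaurentPolynomial.T (m + 1)))
        + B (Dx (LaurentPolynomial.T (m + 1)))
      = (transportDeriv k Dx (B (LaurentPolynomial.T m)) + B (Dx (LaurentPolynomial.T m)))
        * B (LaurentPolynomial.T 1) := by
    rw [LaurentPolynomial.T_add, leibniz_of_map_T Dx hDx, map_mul, transportDeriv_mul k Dx hDx,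
      hone, map_add, map_mul, map_mul, hDx 1]
    simp
    ring
  have hunit : IsUnit (B (LaurentPolynomial.T 1)) := (LaurentPolynomial.isUnit_T 1).map B
  rw [eq_neg_iff_add_eq_zero]
  induction n using Int.induction_on with
  | zero =>
    have h := transportDeriv_mul k Dx hDx 1 1
    rw [mul_one, mul_one, one_mul, left_eq_add] at h
    rw [hDx, LaurentPolynomial.T_zero, map_one, h]
    simp
  | succ m ih => rw [hstep, ih, zero_mul]
  | pred m ih =>
    have h := hstep (-m - 1)
    rwa [sub_add_cancel, ih, eq_comm, hunit.mul_left_eq_zero] at h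

/-- For every Laurent polynomial `p`,
`−B(dp/dx) + k u^{k−1}·∂(Bp)/∂x = ∂(Bp)/∂u` in `L((u⁻¹))`. -/
theorem stmt6 (k : ℕ) (hk : 0 < k)
    (Dx : LaurentPolynomial ℂ →ₗ[ℂ] LaurentPolynomial ℂ)
    (hDx : ∀ n : ℤ, Dx (LaurentPolynomial.T n) = n • LaurentPolynomial.T (n - 1))
    (B : LaurentPolynomial ℂ →ₐ[ℂ] HahnSeries ℤ (LaurentPolynomial ℂ))
    (hB : B (LaurentPolynomial.T 1) = bSeries k)
    (p : LaurentPolynomial ℂ) :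
    -(B (Dx p))
      + (k : HahnSeries ℤ (LaurentPolynomial ℂ))
          * (HahnSeries.single (1 - (k : ℤ)) (1 : LaurentPolynomial ℂ) * derivX Dx (B p))
      = derivU (B p) := by
  suffices h : transportDeriv k Dx (B p) = -B (Dx p) by
    rw [← h, transportDeriv, sub_add_cancel]
  induction p using LaurentPolynomial.induction_on' with
  | add p q hp hq => simp only [map_add, transportDeriv_add, hp, hq, neg_add]
  | C_mul_T n a =>
    rw [← LaurentPolynomial.smul_eq_C_mul, map_smul Dx, Algebra.smul_def, Algebra.smul_def,
      map_mul, map_mul, B.commutes, transportDeriv_algebraMap_mul,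
      transportDeriv_map_T k hk Dx hDx B hB]
    ring
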